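/- Let H₁,…,Hₙ be Hilbert spaces, each of dimension at least 3, f an unentangled frame function, and 𝔐 the associated linear functional on B(H₁) ⊗_alg ⋯ ⊗_alg B(Hₙ). If the restriction of 𝔐 to K(H₁) ⊗_alg ⋯ ⊗_alg K(Hₙ) is bounded, then there exists a unique self-adjoint trace class operator T on H₁ ⊗ ⋯ ⊗ Hₙ with f(ν₁ ⊗ ⋯ ⊗ νₙ) = Tr((p₁ ⊗ ⋯ ⊗ pₙ) T) for all unit simple tensors ν₁ ⊗ ⋯ ⊗ νₙ, p_j the rank-one projection onto ℂν_j. -/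

import Mathlib

open scoped InnerProductSpace

variable {n : ℕ} {H : Fin n → Type*}
  [∀ i, NormedAddCommGroup (H i)] [∀ i, InnerProductSpace ℂ (H i)]
  {E : Type*} [NormedAddCommGroup E] [InnerProductSpace ℂ E]

/-- `t` realizes `E` as the Hilbert tensor product of the `H i`. -/
def IsHilbertTensorMap (t : (∀ i, H i) → E) : Prop :=
  (∀ v w : ∀ i, H i, ⟪t v, t w⟫_ℂ = ∏ i, ⟪v i, w i⟫_ℂ) ∧
  (∀ (v : ∀ i, H i) (i : Fin n) (a b : H i),
      t (Function.update v i (a + b)) =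
        t (Function.update v i a) + t (Function.update v i b)) ∧
  (∀ (v : ∀ i, H i) (i : Fin n) (z : ℂ) (a : H i),
      t (Function.update v i (z • a)) = z • t (Function.update v i a)) ∧
  (Submodule.span ℂ (Set.range t)).topologicalClosure = ⊤

/-- `A ∈ B(H₁ ⊗ ⋯ ⊗ Hₙ)` implements the simple tensor operator
`a₁ ⊗ ⋯ ⊗ aₙ`. -/
def ImplementsTensorOp (t : (∀ i, H i) → E)
    (a : ∀ i, H i →L[ℂ] H i) (A : E →L[ℂ] E) : Prop :=
  ∀ v : ∀ i, H i, A (t v) = t fun i => a i (v i)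

/-- The algebraic tensor product `B(H₁) ⊗_alg ⋯ ⊗_alg B(Hₙ)`, viewed inside
`B(H₁ ⊗ ⋯ ⊗ Hₙ)`. -/
def algTensorOps (t : (∀ i, H i) → E) : Submodule ℂ (E →L[ℂ] E) :=
  Submodule.span ℂ {A | ∃ a, ImplementsTensorOp t a A}

/-- The algebraic tensor product `K(H₁) ⊗_alg ⋯ ⊗_alg K(Hₙ)` of the compact
operators, viewed inside `B(H₁ ⊗ ⋯ ⊗ Hₙ)`. -/
def compactAlgTensorOps (t : (∀ i, H i) → E) : Submodule ℂ (E →L[ℂ] E) :=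
  Submodule.span ℂ
    {A | ∃ a, (∀ i, IsCompactOperator (a i)) ∧ ImplementsTensorOp t a A}

/-- Trace class operators on a Hilbert space: norm-convergent sums
`Σ sₖ • |gₖ⟩⟨eₖ|` with `Σ sₖ < ∞`, `sₖ ≥ 0`, `‖eₖ‖, ‖gₖ‖ ≤ 1`. -/
def IsTraceClassOp [CompleteSpace E] (T : E →L[ℂ] E) : Prop :=
  ∃ (s : ℕ → ℝ) (e g : ℕ → E),
    Summable s ∧ (∀ k, 0 ≤ s k ∧ ‖e k‖ ≤ 1 ∧ ‖g k‖ ≤ 1) ∧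
    HasSum (fun k => s k • ((innerSL ℂ (e k)).smulRight (g k))) T

open InnerProductSpace in
/-- A bounded functional on a space of operators that contains the rank-one operators
`|x⟩⟨y|` with `x`, `y` in a dense subspace is represented there by a bounded operator. -/
lemma exists_operator_representing_functional [CompleteSpace E] {D : Submodule ℂ E}
    (hD : Dense (D : Set E)) {S : Submodule ℂ (E →L[ℂ] E)}
    (hS : ∀ x ∈ D, ∀ y ∈ D, rankOne ℂ x y ∈ S) (φ : S →ₗ[ℂ] ℂ) {C : ℝ}
    (hφ : ∀ A, ‖φ A‖ ≤ C * ‖(A : E →L[ℂ] E)‖) :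
    ∃ T : E →L[ℂ] E, ∀ (x y : D), ⟪T y, (x : E)⟫_ℂ = φ ⟨rankOne ℂ (x : E) (y : E), hS x x.2 y y.2⟩ := by
  let B : D →ₗ⋆[ℂ] D →ₗ[ℂ] ℂ := LinearMap.mk₂'ₛₗ (starRingEnd ℂ) (RingHom.id ℂ)
    (fun y x => φ ⟨rankOne ℂ (x : E) (y : E), hS x x.2 y y.2⟩)
    (fun y y' x => by
      rw [← map_add]; congr 1; ext1; simp)
    (fun c y x => by
      rw [← map_smul]; congr 1; ext1; simp)
    (fun y x x' => by
      rw [← map_add]; congr 1; ext1; simp)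
    (fun c y x => by
      rw [← map_smul]; congr 1; ext1; simp)
  let G : D →L⋆[ℂ] D →L[ℂ] ℂ := B.mkContinuous₂ C fun y x => by
    refine (hφ _).trans_eq ?_
    simp only [norm_rankOne, Submodule.coe_norm]
    ring
  have hd : DenseRange D.subtypeL := by
    rw [DenseRange]; simpa using hD
  have hu : IsUniformInducing D.subtypeL := isUniformInducing_val _
  let G₁ : E →L⋆[ℂ] D →L[ℂ] ℂ := G.extend D.subtypeL
  let G₂ : E →L[ℂ] E →L⋆[ℂ] ℂ := G₁.flip.extend D.subtypeL
  refine ⟨continuousLinearMapOfBilin G₂.flip, fun x y => ?_⟩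
  rw [continuousLinearMapOfBilin_apply]
  change (G₁.flip.extend D.subtypeL) (D.subtypeL x) y = _
  rw [ContinuousLinearMap.extend_eq _ hd hu]
  change (G.extend D.subtypeL) (D.subtypeL y) x = _
  rw [ContinuousLinearMap.extend_eq _ hd hu]
  rfl

open InnerProductSpace in
/-- The trace inequality `|Tr (T A)| ≤ C ‖A‖` extends from finite-rank operators over a dense
subspace to all finite-rank operators. -/
lemma norm_sum_inner_le_of_dense {D : Submodule ℂ E} (hD : Dense (D : Set E))
    {T : E →L[ℂ] E} {C : ℝ} {ι : Type*} [Fintype ι]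
    (h : ∀ x y : ι → D, ‖∑ k, ⟪T (y k), (x k : E)⟫_ℂ‖ ≤ C * ‖∑ k, rankOne ℂ (x k : E) (y k : E)‖)
    (x y : ι → E) :
    ‖∑ k, ⟪T (y k), x k⟫_ℂ‖ ≤ C * ‖∑ k, rankOne ℂ (x k) (y k)‖ := by
  have hd : DenseRange (Subtype.val : D → E) := by
    rw [DenseRange]; simpa using hD
  have hp : DenseRange (Pi.map fun _ : ι => (Subtype.val : D → E)) :=
    DenseRange.piMap fun _ => hd
  have hR : Continuous fun p : E × E => rankOne ℂ p.1 p.2 := by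
    change Continuous fun p : E × E => ContinuousLinearMap.smulRightL ℂ E E (innerSL ℂ p.2) p.1
    fun_prop
  have hr : Continuous fun p : (ι → E) × (ι → E) => ∑ k, rankOne ℂ (p.1 k) (p.2 k) :=
    continuous_finsetSum _ fun k _ => hR.comp (f := fun p : (ι → E) × (ι → E) => (p.1 k, p.2 k))
      (by fun_prop)
  have hi : Continuous fun p : (ι → E) × (ι → E) => ∑ k, ⟪T (p.2 k), p.1 k⟫_ℂ := by fun_prop
  exact hp.induction_on₂ (p := fun x y : ι → E =>
    ‖∑ k, ⟪T (y k), x k⟫_ℂ‖ ≤ C * ‖∑ k, rankOne ℂ (x k) (y k)‖)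
    (isClosed_le hi.norm (continuous_const.mul hr.norm)) (fun x y => h x y) x y

open InnerProductSpace in
lemma norm_sum_rankOne_self_le {ι : Type*} [Fintype ι] {e : ι → E} (he : Orthonormal ℂ e) :
    ‖∑ k, rankOne ℂ (e k) (e k)‖ ≤ 1 := by
  refine ContinuousLinearMap.opNorm_le_bound _ zero_le_one fun v => ?_
  rw [one_mul]
  refine le_of_sq_le_sq ?_ (norm_nonneg v)
  have h := he.sum_inner_products_le (s := Finset.univ) v
  have h2 : ‖∑ k, ⟪e k, v⟫_ℂ • e k‖ ^ 2 = ∑ k, ‖⟪e k, v⟫_ℂ‖ ^ 2 := by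
    have := he.inner_sum (fun k => ⟪e k, v⟫_ℂ) (fun k => ⟪e k, v⟫_ℂ) Finset.univ
    rw [inner_self_eq_norm_sq_to_K] at this
    simp only [RCLike.conj_mul] at this
    exact_mod_cast this
  simpa [sum_apply, h2] using h

open InnerProductSpace in
/-- If `|Tr (T A)| ≤ C ‖A‖` for all finite-rank `A`, then `Tr |T| ≤ C`. -/
lemma norm_sum_inner_cfc_abs_le [CompleteSpace E] {T : E →L[ℂ] E} (hT : IsSelfAdjoint T) {C : ℝ}
    (hC : 0 ≤ C) {ι : Type*} [Fintype ι]
    (h : ∀ x y : ι → E, ‖∑ k, ⟪T (y k), x k⟫_ℂ‖ ≤ C * ‖∑ k, rankOne ℂ (x k) (y k)‖)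
    {e : ι → E} (he : Orthonormal ℂ e) :
    ‖∑ k, ⟪e k, cfc (fun x : ℝ => |x|) T (e k)⟫_ℂ‖ ≤ C := by
  refine le_of_forall_pos_le_add fun δ hδ => ?_
  obtain ⟨ε, hε, hεδ⟩ : ∃ ε : ℝ, 0 < ε ∧ Fintype.card ι * ε ≤ δ := by
    refine ⟨δ / (Fintype.card ι + 1), by positivity, ?_⟩
    rw [mul_div_assoc', div_le_iff₀ (by positivity)]
    nlinarith
  have hne : ∀ x : ℝ, |x| + ε ≠ 0 := fun x => by positivity
  have hcont : Continuous fun x : ℝ => x / (|x| + ε) := by fun_prop (disch := exact hne _)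
  set A := cfc (fun x : ℝ => x / (|x| + ε)) T
  have hAnorm : ‖A‖ ≤ 1 := by
    refine norm_cfc_le zero_le_one fun x _ => ?_
    rw [Real.norm_eq_abs, abs_div, abs_of_pos (a := |x| + ε) (by positivity),
      div_le_one (by positivity)]
    linarith
  have hdiff : ‖cfc (fun x : ℝ => |x|) T - T * A‖ ≤ ε := by
    have : T * A = cfc (fun x : ℝ => x * (x / (|x| + ε))) T := by
      rw [cfc_mul (fun x : ℝ => x) _ T continuousOn_id hcont.continuousOn, cfc_id' ℝ T]
    rw [this, ← cfc_sub (fun x : ℝ => |x|) _ T (by fun_prop)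
      (by fun_prop)]
    refine norm_cfc_le hε.le fun x _ => ?_
    have hx : |x| - x * (x / (|x| + ε)) = ε * |x| / (|x| + ε) := by
      have := hne x
      field_simp
      nlinarith [abs_mul_abs_self x]
    rw [hx, Real.norm_of_nonneg (by positivity), div_le_iff₀ (by positivity)]
    nlinarith [abs_nonneg x]
  have hmain : ‖∑ k, ⟪e k, (T * A) (e k)⟫_ℂ‖ ≤ C := by
    have h1 := h (fun k => A (e k)) e
    have h2 : ∑ k, rankOne ℂ (A (e k)) (e k) = A ∘L ∑ k, rankOne ℂ (e k) (e k) := by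
      ext v; simp
    have h3 : ‖A ∘L ∑ k, rankOne ℂ (e k) (e k)‖ ≤ 1 :=
      (ContinuousLinearMap.opNorm_comp_le _ _).trans
        (mul_le_one₀ hAnorm (norm_nonneg _) (norm_sum_rankOne_self_le he))
    have h4 : ∀ k, ⟪e k, (T * A) (e k)⟫_ℂ = ⟪T (e k), A (e k)⟫_ℂ := fun k =>
      ((ContinuousLinearMap.isSelfAdjoint_iff_isSymmetric.mp hT) _ _).symm
    simp only [h4]
    refine h1.trans ?_
    rw [h2]
    exact mul_le_of_le_one_right hC h3
  have hsplit : ∑ k, ⟪e k, cfc (fun x : ℝ => |x|) T (e k)⟫_ℂ =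
      ∑ k, ⟪e k, (T * A) (e k)⟫_ℂ +
        ∑ k, ⟪e k, (cfc (fun x : ℝ => |x|) T - T * A) (e k)⟫_ℂ := by
    rw [← Finset.sum_add_distrib]
    refine Finset.sum_congr rfl fun k _ => ?_
    rw [← inner_add_right, sub_apply, add_sub_cancel]
  rw [hsplit]
  refine (norm_add_le _ _).trans (add_le_add hmain (le_trans ?_ hεδ))
  rw [← nsmul_eq_mul]
  refine (norm_sum_le_of_le _ fun k _ => ?_).trans_eq (by rw [Finset.sum_const, Finset.card_univ])
  refine (norm_inner_le_norm _ _).trans ?_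
  have := (cfc (fun x : ℝ => |x|) T - T * A).le_of_opNorm_le hdiff (e k)
  simpa [he.1 k] using this

/-- A nuclear expansion over an arbitrary index type can be reindexed by `ℕ`. -/
lemma isTraceClassOp_of_hasSum [CompleteSpace E] {T : E →L[ℂ] E} {ι : Type*} {s : ι → ℝ}
    {e g : ι → E} (hs : Summable s) (hsn : ∀ k, 0 ≤ s k) (he : ∀ k, ‖e k‖ ≤ 1)
    (hg : ∀ k, ‖g k‖ ≤ 1)
    (h : HasSum (fun k => s k • ((innerSL ℂ (e k)).smulRight (g k))) T) : IsTraceClassOp T := by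
  have := hs.countable_support.to_subtype
  obtain ⟨j, hj⟩ := exists_injective_nat (Function.support s)
  let sℕ : ℕ → ℝ := Function.extend j (fun k => s k) 0
  let eℕ : ℕ → E := Function.extend j (fun k => e k) 0
  let gℕ : ℕ → E := Function.extend j (fun k => g k) 0
  have hs0 : ∀ k ∉ Set.range j, sℕ k = 0 := fun k hk => Function.extend_apply' _ _ _ hk
  refine ⟨sℕ, eℕ, gℕ, ?_, fun k => ?_, ?_⟩
  · rw [← hj.summable_iff hs0]
    have hc : sℕ ∘ j = s ∘ Subtype.val := by
      ext k
      simp [sℕ, hj.extend_apply]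
    rw [hc]
    exact hs.subtype (Function.support s)
  · by_cases hk : k ∈ Set.range j
    · obtain ⟨k, rfl⟩ := hk
      simp only [sℕ, eℕ, gℕ, hj.extend_apply]
      exact ⟨hsn _, he _, hg _⟩
    · have hk' : ¬∃ a, j a = k := hk
      simp [sℕ, eℕ, gℕ, Function.extend_apply' _ _ _ hk']
  · rw [← hj.hasSum_iff fun k hk => by rw [hs0 k hk, zero_smul]]
    have hsupp : Function.support (fun k => s k • ((innerSL ℂ (e k)).smulRight (g k))) ⊆
        Function.support s := fun k hk => left_ne_zero_of_smul hk
    refine ((hasSum_subtype_iff_of_support_subset hsupp).mpr h).congr_fun fun k => ?_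
    simp [sℕ, eℕ, gℕ, hj.extend_apply]

/-- A self-adjoint operator with `|Tr (T A)| ≤ C ‖A‖` for all finite-rank `A` is trace class. -/
lemma isTraceClassOp_of_norm_sum_inner_le [CompleteSpace E] {T : E →L[ℂ] E}
    (hT : IsSelfAdjoint T) {C : ℝ} (hC : 0 ≤ C)
    (h : ∀ (m : ℕ) (x y : Fin m → E),
      ‖∑ k, ⟪T (y k), x k⟫_ℂ‖ ≤ C * ‖∑ k, InnerProductSpace.rankOne ℂ (x k) (y k)‖) :
    IsTraceClassOp T := by
  obtain ⟨u, b, -⟩ := exists_hilbertBasis ℂ E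
  set P := cfc (fun x : ℝ => √x + √(-x)) T with hP
  set R := cfc (fun x : ℝ => √x - √(-x)) T with hR
  have hsq : ∀ x : ℝ, √x * √x + √(-x) * √(-x) = |x| ∧ √x * √x - √(-x) * √(-x) = x ∧
      √x * √(-x) = 0 := fun x => by
    rcases le_total 0 x with hx | hx
    · simp [Real.sqrt_eq_zero_of_nonpos (neg_nonpos.2 hx), Real.mul_self_sqrt hx, abs_of_nonneg hx]
    · simp [Real.sqrt_eq_zero_of_nonpos hx, Real.mul_self_sqrt (neg_nonneg.2 hx), abs_of_nonpos hx]
  have hPP : P * P = cfc (fun x : ℝ => |x|) T := by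
    rw [hP, ← cfc_mul _ _ T (by fun_prop) (by fun_prop)]
    congr 1; ext x; linarith [hsq x]
  have hRR : R * R = cfc (fun x : ℝ => |x|) T := by
    rw [hR, ← cfc_mul _ _ T (by fun_prop) (by fun_prop)]
    congr 1; ext x; linarith [hsq x]
  have hRP : R * P = T := by
    conv_rhs => rw [← cfc_id' ℝ T]
    rw [hR, hP, ← cfc_mul _ _ T (by fun_prop) (by fun_prop)]
    congr 1; ext x; linarith [hsq x]
  have hPsa : IsSelfAdjoint P := cfc_predicate _ T
  have hRsa : IsSelfAdjoint R := cfc_predicate _ T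
  have hPs := ContinuousLinearMap.isSelfAdjoint_iff_isSymmetric.mp hPsa
  have hRs := ContinuousLinearMap.isSelfAdjoint_iff_isSymmetric.mp hRsa
  have hPn : ∀ v, ((‖P v‖ ^ 2 : ℝ) : ℂ) = ⟪v, cfc (fun x : ℝ => |x|) T v⟫_ℂ := fun v => by
    rw [← hPP, Complex.ofReal_pow]
    exact (inner_self_eq_norm_sq_to_K (𝕜 := ℂ) (P v)).symm.trans (hPs _ _)
  have hRn : ∀ v, ((‖R v‖ ^ 2 : ℝ) : ℂ) = ⟪v, cfc (fun x : ℝ => |x|) T v⟫_ℂ := fun v => by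
    rw [← hRR, Complex.ofReal_pow]
    exact (inner_self_eq_norm_sq_to_K (𝕜 := ℂ) (R v)).symm.trans (hRs _ _)
  have hnorm : ∀ v, ‖R v‖ = ‖P v‖ := fun v => by
    have := (hRn v).trans (hPn v).symm
    exact (pow_left_inj₀ (norm_nonneg _) (norm_nonneg _) two_ne_zero).mp (by exact_mod_cast this)
  have hsum : Summable fun i => ‖P (b i)‖ ^ 2 := by
    refine summable_of_sum_le (c := C) (fun _ => by positivity) fun v => ?_
    have h1 := norm_sum_inner_cfc_abs_le hT hC (h v.card)
      (b.orthonormal.comp (fun k => (v.equivFin.symm k : u))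
        (Subtype.val_injective.comp v.equivFin.symm.injective))
    simp only [Function.comp_apply, ← hPn] at h1
    rw [← Complex.ofReal_sum, Complex.norm_real,
      Real.norm_of_nonneg (Finset.sum_nonneg fun _ _ => by positivity),
      Equiv.sum_comp v.equivFin.symm fun k : v => ‖P (b k)‖ ^ 2] at h1
    rwa [← Finset.sum_coe_sort]
  have hop : ∀ i, ‖P (b i)‖ ^ 2 • (innerSL ℂ ((‖P (b i)‖⁻¹ : ℂ) • P (b i))).smulRight
      ((‖R (b i)‖⁻¹ : ℂ) • R (b i)) = (innerSL ℂ (P (b i))).smulRight (R (b i)) := fun i => by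
    by_cases h0 : ‖P (b i)‖ = 0
    · have : P (b i) = 0 := norm_eq_zero.mp h0
      simp [this]
    · have h0' : (‖P (b i)‖ : ℂ) ≠ 0 := by exact_mod_cast h0
      ext v
      rw [hnorm, ← Complex.coe_smul]
      simp only [smul_apply, ContinuousLinearMap.smulRight_apply, innerSL_apply_apply,
        inner_smul_left, smul_smul]
      congr 1
      simp
      field_simp
  have hunit : ∀ v : E, ‖(‖v‖⁻¹ : ℂ) • v‖ ≤ 1 := fun v => by
    rw [norm_smul]
    simpa using inv_mul_le_one
  refine isTraceClassOp_of_hasSum hsum (fun _ => by positivity) (fun i => hunit (P (b i)))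
    (fun i => hunit (R (b i))) ?_
  simp only [hop]
  have hs : Summable fun i => (innerSL ℂ (P (b i))).smulRight (R (b i)) := by
    refine Summable.of_norm (hsum.congr fun i => ?_)
    rw [ContinuousLinearMap.norm_smulRight_apply, innerSL_apply_norm, hnorm, sq]
  convert hs.hasSum using 1
  ext v
  have h1 := hs.hasSum.mapL (ContinuousLinearMap.apply ℂ E v)
  have h2 := (b.hasSum_repr (P v)).mapL R
  refine HasSum.unique (f := fun i => ⟪P (b i), v⟫_ℂ • R (b i)) ?_ (by simpa using h1)
  convert h2 using 1
  · ext i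
    rw [map_smul, HilbertBasis.repr_apply_apply]
    congr 1
    exact hPs _ _
  · rw [← hRP]; rfl

namespace IsHilbertTensorMap

variable {t : (∀ i, H i) → E}

/-- The multilinear map underlying a Hilbert tensor product. -/
def toMultilinearMap (ht : IsHilbertTensorMap t) : MultilinearMap ℂ H E :=
  MultilinearMap.mk' t ht.2.1 ht.2.2.1

lemma map_smul_univ (ht : IsHilbertTensorMap t) (c : Fin n → ℂ) (v : ∀ i, H i) :
    t (fun i => c i • v i) = (∏ i, c i) • t v :=
  ht.toMultilinearMap.map_smul_univ c v

lemma dense_span (ht : IsHilbertTensorMap t) :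
    Dense (Submodule.span ℂ (Set.range t) : Set E) :=
  Submodule.dense_iff_topologicalClosure_eq_top.mpr ht.2.2.2

/-- Polarization: an operator is zero if its quadratic form vanishes on unit simple tensors. -/
lemma eq_zero_of_inner_eq_zero (ht : IsHilbertTensorMap t) {S : E →L[ℂ] E}
    (hS : ∀ ν : ∀ j, H j, (∀ j, ‖ν j‖ = 1) → ⟪S (t ν), t ν⟫_ℂ = 0) : S = 0 := by
  have hdiag : ∀ v, ⟪S (t v), t v⟫_ℂ = 0 := fun v => by
    by_cases hv : ∃ i, v i = 0
    · obtain ⟨i, hi⟩ := hv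
      have : t v = 0 := ht.toMultilinearMap.map_coord_zero i hi
      simp [this]
    · push Not at hv
      have hv' : t v = (∏ i, (‖v i‖ : ℂ)) • t fun i => (‖v i‖⁻¹ : ℂ) • v i := by
        rw [← ht.map_smul_univ]
        congr 1
        ext i
        rw [smul_inv_smul₀ (by simpa using hv i)]
      rw [hv', map_smul, inner_smul_left, inner_smul_right, hS _ fun i => ?_, mul_zero, mul_zero]
      simp [norm_smul, hv i]
  have hoff : ∀ s : Finset (Fin n), ∀ v w : ∀ i, H i, (∀ i ∉ s, v i = w i) →
      ⟪S (t v), t w⟫_ℂ = 0 := by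
    intro s
    induction s using Finset.induction_on with
    | empty =>
      intro v w h
      obtain rfl : v = w := funext fun i => h i (by simp)
      exact hdiag v
    | insert i s hi ih =>
      intro v w h
      have key : ∀ c : H i,
          ⟪S (t (Function.update v i c)), t (Function.update w i c)⟫_ℂ = 0 := fun c =>
        ih _ _ fun k hk => by
          by_cases hki : k = i
          · subst hki; simp
          · simpa [hki] using h k (by simp [hki, hk])
      have h1 := key (v i + w i)
      have h2 := key (v i + Complex.I • w i)
      simp only [ht.2.1, ht.2.2.1, map_add, map_smul, inner_add_left, inner_add_right,
        inner_smul_left, inner_smul_right, Function.update_eq_self, Complex.conj_I] at h1 h2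
      have kv := key (v i)
      have kw := key (w i)
      rw [Function.update_eq_self] at kv kw
      set b := ⟪S (t (Function.update v i (w i))), t (Function.update w i (v i))⟫_ℂ
      linear_combination (1 / 2 : ℂ) * h1 - (Complex.I / 2) * h2 - (1 / 2 - Complex.I / 2) * kv -
        (1 / 2 + Complex.I ^ 3 / 2) * kw - (b - ⟪S (t v), t w⟫_ℂ) / 2 * Complex.I_sq
  have hzero : ∀ v w, ⟪S (t v), t w⟫_ℂ = 0 := fun v w => hoff Finset.univ v w (by simp)
  have hval : ∀ v, S (t v) = 0 := fun v => by
    refine ht.dense_span.eq_zero_of_inner_left (𝕜 := ℂ) fun y hy => ?_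
    induction hy using Submodule.span_induction with
    | mem y hy =>
      obtain ⟨w, rfl⟩ := hy
      exact hzero v w
    | zero => simp
    | add x y _ _ hx hy => rw [inner_add_right, hx, hy, add_zero]
    | smul c x _ hx => rw [inner_smul_right, hx, mul_zero]
  refine ContinuousLinearMap.ext_on ht.dense_span ?_
  rintro _ ⟨v, rfl⟩
  simpa using hval v

/-- The rank-one operator between simple tensors is the tensor product of rank-one operators. -/
lemma implementsTensorOp_rankOne (ht : IsHilbertTensorMap t) (v w : ∀ i, H i) :
    ImplementsTensorOp t (fun i => InnerProductSpace.rankOne ℂ (v i) (w i))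
      (InnerProductSpace.rankOne ℂ (t v) (t w)) := fun u => by
  simp only [InnerProductSpace.rankOne_apply, ht.map_smul_univ, ht.1]

lemma rankOne_mem_compactAlgTensorOps (ht : IsHilbertTensorMap t) {x y : E}
    (hx : x ∈ Submodule.span ℂ (Set.range t)) (hy : y ∈ Submodule.span ℂ (Set.range t)) :
    InnerProductSpace.rankOne ℂ x y ∈ compactAlgTensorOps t := by
  induction hx using Submodule.span_induction with
  | zero => simp
  | add x x' _ _ h h' => simpa using add_mem h h'
  | smul c x _ h => simpa using Submodule.smul_mem _ c h
  | mem x hx =>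
    obtain ⟨v, rfl⟩ := hx
    induction hy using Submodule.span_induction with
    | zero => simp
    | add y y' _ _ h h' => simpa using add_mem h h'
    | smul c y _ h => simpa using Submodule.smul_mem _ (starRingEnd ℂ c) h
    | mem y hy =>
      obtain ⟨w, rfl⟩ := hy
      refine Submodule.subset_span ⟨_, fun i => ?_, ht.implementsTensorOp_rankOne v w⟩
      rw [InnerProductSpace.rankOne_def']
      exact (isCompactOperator_of_locallyCompactSpace_dom (innerSL ℂ (w i))).clm_comp
        (ContinuousLinearMap.toSpanSingleton ℂ (v i))

end IsHilbertTensorMap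

lemma compactAlgTensorOps_le_algTensorOps (t : (∀ i, H i) → E) :
    compactAlgTensorOps t ≤ algTensorOps t :=
  Submodule.span_mono fun _ ⟨a, _, ha⟩ => ⟨a, ha⟩

/-- Generalised unentangled Gleason theorem (infinite dimensions): if `f` is an
unentangled frame function on Hilbert spaces of dimension at least 3 and the
linear functional `𝔐` associated with `f` on the algebraic tensor product
`B(H₁) ⊗_alg ⋯ ⊗_alg B(Hₙ)` restricts to a bounded functional on
`K(H₁) ⊗_alg ⋯ ⊗_alg K(Hₙ)`, then there is a unique self-adjoint trace class
operator `T` with `f(ν₁ ⊗ ⋯ ⊗ νₙ) = Tr((p₁ ⊗ ⋯ ⊗ pₙ) T)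
= ⟪T(ν₁ ⊗ ⋯ ⊗ νₙ), ν₁ ⊗ ⋯ ⊗ νₙ⟫` for all unit simple tensors. -/
theorem unentangled_gleason_infinite_dimensional
    [∀ i, CompleteSpace (H i)] [CompleteSpace E]
    (hdim : ∀ i, 3 ≤ Module.rank ℂ (H i))
    (t : (∀ i, H i) → E) (ht : IsHilbertTensorMap t)
    (f : E → ℝ) (w : ℝ)
    -- `f` is an unentangled frame function of weight `w`
    (hf_nonneg : ∀ x, 0 ≤ f x)
    (hf : ∀ (ι : Type) (b : HilbertBasis ι ℂ E),
      (∀ i, ∃ ν : ∀ j, H j, (∀ j, ‖ν j‖ = 1) ∧ b i = t ν) →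
      HasSum (fun i => f (b i)) w)
    -- `𝔐` is the linear functional associated with `f` on the algebraic
    -- tensor product: on a simple tensor of projections it is given by
    -- summing `f` over a product of orthonormal bases of the ranges
    (𝔐 : algTensorOps t →ₗ[ℂ] ℂ)
    (h𝔐 : ∀ (I : Fin n → Type) (ξ : ∀ j, I j → H j)
        (p : ∀ j, H j →L[ℂ] H j) (A : E →L[ℂ] E)
        (hA : A ∈ algTensorOps t),
        (∀ j, Orthonormal ℂ (ξ j)) →
        (∀ j, ∀ v : H j, HasSum (fun i => ⟪ξ j i, v⟫_ℂ • ξ j i) (p j v)) →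
        ImplementsTensorOp t p A →
        ∃ s : ℝ, HasSum (fun i : ∀ j, I j => f (t fun j => ξ j (i j))) s ∧
          𝔐 ⟨A, hA⟩ = (s : ℂ))
    -- the restriction of `𝔐` to `K(H₁) ⊗_alg ⋯ ⊗_alg K(Hₙ)` is bounded
    (hbdd : ∃ C : ℝ, ∀ (A : E →L[ℂ] E) (hA : A ∈ algTensorOps t),
        A ∈ compactAlgTensorOps t → ‖𝔐 ⟨A, hA⟩‖ ≤ C * ‖A‖) :
    ∃! T : E →L[ℂ] E, IsTraceClassOp T ∧ IsSelfAdjoint T ∧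
      ∀ ν : ∀ j, H j, (∀ j, ‖ν j‖ = 1) →
        (f (t ν) : ℂ) = ⟪T (t ν), t ν⟫_ℂ := by
  obtain ⟨C₀, hC₀⟩ := hbdd
  obtain ⟨C, hC, hbdd⟩ : ∃ C : ℝ, 0 ≤ C ∧ ∀ (A : E →L[ℂ] E) (hA : A ∈ algTensorOps t),
      A ∈ compactAlgTensorOps t → ‖𝔐 ⟨A, hA⟩‖ ≤ C * ‖A‖ :=
    ⟨|C₀|, abs_nonneg _, fun A hA hK => (hC₀ A hA hK).trans (by gcongr; exact le_abs_self _)⟩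
  let φ := 𝔐 ∘ₗ Submodule.inclusion (compactAlgTensorOps_le_algTensorOps t)
  have hφ : ∀ A, ‖φ A‖ ≤ C * ‖(A : E →L[ℂ] E)‖ := fun A => hbdd A _ A.2
  have hD := ht.dense_span
  obtain ⟨T, hT⟩ := exists_operator_representing_functional hD
    (fun x hx y hy => ht.rankOne_mem_compactAlgTensorOps hx hy) φ hφ
  have hfT : ∀ ν : ∀ j, H j, (∀ j, ‖ν j‖ = 1) → (f (t ν) : ℂ) = ⟪T (t ν), t ν⟫_ℂ := by
    intro ν hν
    have hmem : t ν ∈ Submodule.span ℂ (Set.range t) := Submodule.subset_span ⟨ν, rfl⟩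
    obtain ⟨s, hs, hs'⟩ := h𝔐 (fun _ => Unit) (fun j _ => ν j)
      (fun j => InnerProductSpace.rankOne ℂ (ν j) (ν j))
      (InnerProductSpace.rankOne ℂ (t ν) (t ν))
      (compactAlgTensorOps_le_algTensorOps t (ht.rankOne_mem_compactAlgTensorOps hmem hmem))
      (fun j => ⟨fun _ => hν j, fun a b hab => (hab (Subsingleton.elim a b)).elim⟩)
      (fun j v => hasSum_unique fun _ : Unit => ⟪ν j, v⟫_ℂ • ν j)
      (ht.implementsTensorOp_rankOne ν ν)
    have hfs : f (t ν) = s := (hasSum_unique _).unique hs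
    rw [hfs, ← hs']
    exact (hT ⟨t ν, hmem⟩ ⟨t ν, hmem⟩).symm
  have hsa : IsSelfAdjoint T := by
    refine sub_eq_zero.mp (ht.eq_zero_of_inner_eq_zero fun ν hν => ?_)
    rw [sub_apply, inner_sub_left, ContinuousLinearMap.star_eq_adjoint,
      ContinuousLinearMap.adjoint_inner_left, ← inner_conj_symm, ← hfT ν hν, Complex.conj_ofReal,
      sub_self]
  refine ⟨T, ⟨?_, hsa, hfT⟩, fun T' ⟨_, _, hT'⟩ => ?_⟩
  · refine isTraceClassOp_of_norm_sum_inner_le hsa hC fun m =>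
      norm_sum_inner_le_of_dense hD fun x y => ?_
    have h := hφ (∑ k, ⟨InnerProductSpace.rankOne ℂ (x k : E) (y k : E),
      ht.rankOne_mem_compactAlgTensorOps (x k).2 (y k).2⟩)
    simpa [map_sum, ← hT] using h
  · refine sub_eq_zero.mp (ht.eq_zero_of_inner_eq_zero fun ν hν => ?_)
    rw [sub_apply, inner_sub_left, ← hT' ν hν, ← hfT ν hν, sub_self]
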